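/- Let d ≥ 1, m ∈ ℝ, and a ∈ S^m_{1,1}. For k ≥ 3 define the near-diagonal symbol d_k(x,ξ) := Σ_{j=k−2}^{k+2} a_{j,k}(x,ξ). Then for every σ > 0 there is a constant C, independent of k, x, and f, such that |T_{d_k} f(x)| ≤ C · 2^{km} · 𝔐_{σ,2^k}(Π*_k f)(x) for all k ≥ 3, all x ∈ ℝ^d, and all Schwartz functions f. -/

import Mathlib

noncomputable section

open MeasureTheory SchwartzMap Complex RealInnerProductSpace Filter
open scoped ENNReal NNReal ContDiff SchwartzMap

/-- Euclidean space `ℝ^d`. -/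
abbrev RD (d : ℕ) : Type := EuclideanSpace ℝ (Fin d)

/-- Tempered distributions on `ℝ^d`. -/
abbrev TD (d : ℕ) : Type := 𝓢(RD d, ℂ) →L[ℂ] ℂ

/-- Fourier transform of a Schwartz function (with the convention
`f̂(ξ) = ∫ f(x) e^{-2πi⟨x,ξ⟩} dx`). -/
def fourierS {d : ℕ} (f : 𝓢(RD d, ℂ)) : 𝓢(RD d, ℂ) :=
  SchwartzMap.fourierTransformCLM ℂ f

/-- Hörmander symbol class `S^m_{1,1}`: `a` is smooth and
`‖∂_ξ^α ∂_x^β a(x,ξ)‖ ≤ c_{α,β} (1+‖ξ‖)^{m-|α|+|β|}` for all orders of derivatives. -/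
def IsSymbolS11 (d : ℕ) (m : ℝ) (a : RD d → RD d → ℂ) : Prop :=
  ContDiff ℝ ∞ (fun p : RD d × RD d => a p.1 p.2) ∧
  ∀ α β : ℕ, ∃ c : ℝ, ∀ x ξ : RD d,
    ‖iteratedFDeriv ℝ α (fun ξ' => iteratedFDeriv ℝ β (fun x' => a x' ξ') x) ξ‖
      ≤ c * (1 + ‖ξ‖) ^ (m - (α : ℝ) + (β : ℝ))

/-- The pseudo-differential operator `T_a f(x) = ∫ a(x,ξ) f̂(ξ) e^{2πi⟨x,ξ⟩} dξ`
acting on a Schwartz function `f`. -/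
def pdo {d : ℕ} (a : RD d → RD d → ℂ) (f : 𝓢(RD d, ℂ)) (x : RD d) : ℂ :=
  ∫ ξ, a x ξ * fourierS f ξ * Complex.exp (2 * Real.pi * Complex.I * ((⟪x, ξ⟫ : ℝ) : ℂ))

/-- Littlewood–Paley data: a Schwartz function `φ` with `φ̂` supported in
`{1/2 ≤ |ξ| ≤ 2}` and `Σ_{k∈ℤ} φ̂(2^{-k}ξ) = 1` for `ξ ≠ 0`, together with the
low-frequency piece `Φ` determined by `Φ̂ = 1 - Σ_{k≥1} φ̂(2^{-k}·)`. -/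
structure LPData (d : ℕ) where
  φ : 𝓢(RD d, ℂ)
  Φ : 𝓢(RD d, ℂ)
  supp_φ : ∀ ξ : RD d, fourierS φ ξ ≠ 0 → 1/2 ≤ ‖ξ‖ ∧ ‖ξ‖ ≤ 2
  sum_φ : ∀ ξ : RD d, ξ ≠ 0 → HasSum (fun k : ℤ => fourierS φ ((2:ℝ)^(-k) • ξ)) 1
  Φ_def : ∀ ξ : RD d, fourierS Φ ξ = 1 - ∑' k : ℕ, fourierS φ (((2:ℝ)^(k+1))⁻¹ • ξ)

/-- The Littlewood–Paley convolution kernel: `Φ` for `k = 0` and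
`φ_k = 2^{kd} φ(2^k ·)` for `k ≥ 1`. -/
def LPkernel {d : ℕ} (D : LPData d) : ℕ → RD d → ℂ
  | 0, x => D.Φ x
  | (k+1), x => (((2:ℝ)^((k+1) * d) : ℝ) : ℂ) * D.φ ((2:ℝ)^(k+1) • x)

/-- The Fourier transform of the `k`-th Littlewood–Paley kernel, i.e. `φ̂_k = φ̂(2^{-k}·)`
for `k ≥ 1` and `Φ̂` for `k = 0`. -/
def LPhat {d : ℕ} (D : LPData d) : ℕ → RD d → ℂ
  | 0, ξ => fourierS D.Φ ξ
  | (k+1), ξ => fourierS D.φ (((2:ℝ)^(k+1))⁻¹ • ξ)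

/-- Littlewood–Paley operator `Π_k g = φ_k ∗ g` (with `φ_0 := Φ`) acting on functions. -/
def LP {d : ℕ} (D : LPData d) (k : ℕ) (g : RD d → ℂ) (x : RD d) : ℂ :=
  ∫ y, LPkernel D k y * g (x - y)

/-- `Π*_k = Π_{k-1} + Π_k + Π_{k+1}` (with the convention `φ_{-1} := 0`). -/
def LPstar {d : ℕ} (D : LPData d) (k : ℕ) (g : RD d → ℂ) (x : RD d) : ℂ :=
  (if k = 0 then 0 else LP D (k-1) g x) + LP D k g x + LP D (k+1) g x

open Classical in
/-- Pairing of a tempered distribution with a plain function: it gives `u ψ` if the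
function is (the coercion of) a Schwartz function `ψ`, and `0` otherwise. -/
def pairing {d : ℕ} (u : TD d) (g : RD d → ℂ) : ℂ :=
  if h : ∃ ψ : 𝓢(RD d, ℂ), ⇑ψ = g then u h.choose else 0

/-- Fourier transform of a tempered distribution, `⟨û, ψ⟩ = ⟨u, ψ̂⟩`. -/
def fourierTD {d : ℕ} (u : TD d) : TD d :=
  u.comp (SchwartzMap.fourierTransformCLM ℂ)

/-- Littlewood–Paley operator on tempered distributions:
`Π_k u (x) = ⟨u, φ_k(x - ·)⟩`. -/
def LPdist {d : ℕ} (D : LPData d) (k : ℕ) (u : TD d) (x : RD d) : ℂ :=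
  pairing u (fun y => LPkernel D k (x - y))

/-- The symbol `a_{j,k}(x,ξ) = (φ_j ∗ a(·,ξ))(x) · φ̂_k(ξ)` (with `Φ` replacing `φ_0`). -/
def symbolPiece {d : ℕ} (D : LPData d) (a : RD d → RD d → ℂ) (j k : ℕ)
    (x ξ : RD d) : ℂ :=
  (∫ y, LPkernel D j y * a (x - y) ξ) * LPhat D k ξ

/-- `T_{a_{j,k}} u (x) = ⟨û, a_{j,k}(x,·) e^{2πi⟨x,·⟩}⟩` for a tempered distribution `u`. -/
def pdoPieceD {d : ℕ} (D : LPData d) (a : RD d → RD d → ℂ) (j k : ℕ)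
    (u : TD d) (x : RD d) : ℂ :=
  pairing (fourierTD u)
    (fun ξ => symbolPiece D a j k x ξ * Complex.exp (2 * Real.pi * Complex.I * ((⟪x, ξ⟫ : ℝ) : ℂ)))

/-- Partial sums `Σ_{j=0}^N Σ_{k=0}^N T_{a_{j,k}} u (x)`. -/
def pdoPartial {d : ℕ} (D : LPData d) (a : RD d → RD d → ℂ) (N : ℕ)
    (u : TD d) (x : RD d) : ℂ :=
  ∑ j ∈ Finset.range (N+1), ∑ k ∈ Finset.range (N+1), pdoPieceD D a j k u x

/-- `T_a u` converges in `S'` to the tempered distribution `Tf`: the partial sums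
`Σ_{j,k≤N} T_{a_{j,k}} u` (which are functions) converge to `Tf` weakly. -/
def ConvergesInSPrime {d : ℕ} (D : LPData d) (a : RD d → RD d → ℂ)
    (u : TD d) (Tf : TD d) : Prop :=
  ∀ ψ : 𝓢(RD d, ℂ),
    Tendsto (fun N => ∫ x, pdoPartial D a N u x * ψ x) atTop (nhds (Tf ψ))

/-- The dyadic cube of level `ν` (side length `2^{-ν}`) indexed by `n ∈ ℤ^d`. -/
def dyadicCube (d : ℕ) (ν : ℤ) (n : Fin d → ℤ) : Set (RD d) :=
  {x | ∀ i, (n i : ℝ) * (2:ℝ)^(-ν) ≤ x i ∧ x i < ((n i : ℝ) + 1) * (2:ℝ)^(-ν)}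

/-- The local quantity `(|P|⁻¹ ∫_P Σ_{k=k₀}^∞ 2^{skq} ‖g_k(x)‖^q dx)^{1/q}` for the
dyadic cube `P` of level `μ` indexed by `n` (so that `|P|⁻¹ = 2^{μd}`). -/
def cubePiece (d : ℕ) (μ : ℕ) (n : Fin d → ℤ) (k₀ : ℕ) (s q : ℝ)
    (g : ℕ → RD d → ℂ) : ℝ≥0∞ :=
  ((2:ℝ≥0∞)^((μ:ℝ)*(d:ℝ)) *
    ∫⁻ x in dyadicCube d μ n,
      ∑' j : ℕ, (2:ℝ≥0∞)^(s*((k₀:ℝ)+(j:ℝ))*q) * (‖g (k₀+j) x‖₊ : ℝ≥0∞)^q) ^ (1/q)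

/-- The `F_∞^{s,q}` norm (for `q < ∞`) of a function, computed from its
Littlewood–Paley pieces:
`‖Π_0 g‖_∞ + sup_{l(P)<1 dyadic} (|P|⁻¹ ∫_P Σ_{k=-log₂ l(P)}^∞ 2^{skq}|Π_k g|^q)^{1/q}`. -/
def FinftyNormFun {d : ℕ} (D : LPData d) (s q : ℝ) (g : RD d → ℂ) : ℝ≥0∞ :=
  (⨆ x : RD d, (‖LP D 0 g x‖₊ : ℝ≥0∞)) +
  ⨆ (μ : ℕ) (_ : 1 ≤ μ) (n : Fin d → ℤ),
    cubePiece d μ n μ s q (fun k x => LP D k g x)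

/-- The `F_∞^{s,q}` norm (for `q < ∞`) of a tempered distribution. -/
def FinftyNormDist {d : ℕ} (D : LPData d) (s q : ℝ) (u : TD d) : ℝ≥0∞ :=
  (⨆ x : RD d, (‖LPdist D 0 u x‖₊ : ℝ≥0∞)) +
  ⨆ (μ : ℕ) (_ : 1 ≤ μ) (n : Fin d → ℤ),
    cubePiece d μ n μ s q (fun k x => LPdist D k u x)

/-- The (axis-parallel, closed) cube with corner `c` and side length `L`. -/
def cube (d : ℕ) (c : RD d) (L : ℝ) : Set (RD d) :=
  {x | ∀ i, c i ≤ x i ∧ x i ≤ c i + L}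

/-- The average of `g` over the cube with corner `c` and side length `L`. -/
def cubeMean {d : ℕ} (c : RD d) (L : ℝ) (g : RD d → ℂ) : ℂ :=
  (L^d)⁻¹ • ∫ x in cube d c L, g x

/-- The `bmo` norm (local BMO):
`sup_{l(Q)≥1} |Q|⁻¹∫_Q |g| + sup_{l(Q)<1} |Q|⁻¹∫_Q |g - g_Q|`, over all cubes `Q`. -/
def bmoNorm (d : ℕ) (g : RD d → ℂ) : ℝ≥0∞ :=
  (⨆ (c : RD d) (L : ℝ) (_ : 1 ≤ L),
    ENNReal.ofReal ((L^d)⁻¹) * ∫⁻ x in cube d c L, (‖g x‖₊ : ℝ≥0∞)) +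
  (⨆ (c : RD d) (L : ℝ) (_ : 0 < L) (_ : L < 1),
    ENNReal.ofReal ((L^d)⁻¹) * ∫⁻ x in cube d c L, (‖g x - cubeMean c L g‖₊ : ℝ≥0∞))

/-- The Peetre maximal function `𝔐_{σ,R} g(x) = sup_y ‖g(x-y)‖/(1+R‖y‖)^σ`. -/
def peetre {d : ℕ} (σ R : ℝ) (g : RD d → ℂ) (x : RD d) : ℝ≥0∞ :=
  ⨆ y : RD d, (‖g (x - y)‖₊ : ℝ≥0∞) / ENNReal.ofReal ((1 + R * ‖y‖) ^ σ)

/-- `g` has (distributional) Fourier support contained in `K`: the pairing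
`⟨ĝ, ψ⟩ = ∫ g · ψ̂` vanishes for every Schwartz `ψ` whose support does not meet `K`. -/
def HasFourierSupportIn {d : ℕ} (g : RD d → ℂ) (K : Set (RD d)) : Prop :=
  ∀ ψ : 𝓢(RD d, ℂ), tsupport ⇑ψ ∩ K = ∅ → ∫ x, g x * fourierS ψ x = 0

/-- The near-diagonal symbol `d_k(x,ξ) = Σ_{j=max(0,k-2)}^{k+2} a_{j,k}(x,ξ)`. -/
def dsym {d : ℕ} (D : LPData d) (a : RD d → RD d → ℂ) (k : ℕ) (x ξ : RD d) : ℂ :=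
  ∑ j ∈ Finset.Icc (k-2) (k+2), symbolPiece D a j k x ξ

open FourierTransform

lemma integral_dilate {d : ℕ} {F : Type*} [NormedAddCommGroup F] [NormedSpace ℝ F]
    (h : RD d → F) {R : ℝ} (hR : 0 < R) :
    ∫ x, R ^ d • h (R • x) = ∫ x, h x := by
  rw [integral_smul, Measure.integral_comp_smul_of_nonneg volume h R (hR := hR.le), smul_smul]
  simp [hR.ne']

lemma fourier_dilate {d : ℕ} (h : RD d → ℂ) {R : ℝ} (hR : 0 < R) (ξ : RD d) :
    𝓕 (fun x => ((R ^ d : ℝ) : ℂ) * h (R • x)) ξ = 𝓕 h (R⁻¹ • ξ) := by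
  rw [Real.fourier_eq', Real.fourier_eq',
    ← integral_dilate (fun v => cexp (((-2 * Real.pi * ⟪v, R⁻¹ • ξ⟫ : ℝ) : ℂ) * I) • h v) hR]
  congr 1
  ext v
  rw [inner_smul_left, inner_smul_right, conj_trivial, mul_inv_cancel_left₀ hR.ne']
  simp only [smul_eq_mul, Complex.real_smul]
  ring

/-- The `L¹`-normalised dilation `x ↦ R^d h(R x)` of a Schwartz function. -/
def dilateS {d : ℕ} (h : 𝓢(RD d, ℂ)) (R : ℝ) (hR : R ≠ 0) : 𝓢(RD d, ℂ) :=
  ((R ^ d : ℝ) : ℂ) • SchwartzMap.compCLMOfContinuousLinearEquiv ℂ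
    (ContinuousLinearEquiv.smulLeft (Units.mk0 R hR)) h

lemma dilateS_apply {d : ℕ} (h : 𝓢(RD d, ℂ)) (R : ℝ) (hR : R ≠ 0) (x : RD d) :
    dilateS h R hR x = ((R ^ d : ℝ) : ℂ) * h (R • x) := rfl

lemma fourier_dilateS {d : ℕ} (h : 𝓢(RD d, ℂ)) {R : ℝ} (hR : 0 < R) (ξ : RD d) :
    𝓕 (dilateS h R hR.ne') ξ = 𝓕 h (R⁻¹ • ξ) := by
  rw [SchwartzMap.fourier_coe, SchwartzMap.fourier_coe]
  exact fourier_dilate h hR ξ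

lemma fourierInv_dilateS {d : ℕ} (h : 𝓢(RD d, ℂ)) {R : ℝ} (hR : 0 < R) (y : RD d) :
    𝓕⁻ (dilateS h R hR.ne') y = 𝓕⁻ h (R⁻¹ • y) := by
  simp only [SchwartzMap.fourierInv_coe, Real.fourierInv_eq_fourier_neg,
    ← SchwartzMap.fourier_coe]
  rw [fourier_dilateS h hR, smul_neg]

/-- Convolution of scalar Schwartz functions. -/
def convS {d : ℕ} (u v : 𝓢(RD d, ℂ)) : 𝓢(RD d, ℂ) :=
  SchwartzMap.convolution (ContinuousLinearMap.mul ℂ ℂ) u v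

lemma convS_apply {d : ℕ} (u v : 𝓢(RD d, ℂ)) (x : RD d) :
    convS u v x = ∫ y, u y * v (x - y) := by
  rw [convS, SchwartzMap.convolution_apply]
  rfl

lemma fourier_convS {d : ℕ} (u v : 𝓢(RD d, ℂ)) (ξ : RD d) :
    𝓕 (convS u v) ξ = 𝓕 u ξ * 𝓕 v ξ := by
  rw [convS, SchwartzMap.fourier_convolution]
  rfl

lemma integral_mul_fourier_mul_exp {d : ℕ} (B W f : 𝓢(RD d, ℂ))
    (hBW : ∀ ξ, B ξ * 𝓕 W ξ = B ξ) (x : RD d) :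
    ∫ ξ, B ξ * 𝓕 f ξ * cexp (2 * Real.pi * I * ((⟪x, ξ⟫ : ℝ) : ℂ)) =
      ∫ y, 𝓕⁻ B y * convS W f (x - y) := by
  have hinv : convS (𝓕⁻ B) (convS W f) = 𝓕⁻ (𝓕 (convS (𝓕⁻ B) (convS W f))) := by simp
  rw [← convS_apply, hinv, SchwartzMap.fourierInv_coe, Real.fourierInv_eq']
  congr 1
  ext ξ
  rw [fourier_convS, fourier_convS, FourierTransform.fourier_fourierInv_eq, ← mul_assoc, hBW,
    smul_eq_mul, mul_comm, real_inner_comm]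
  congr 2
  push_cast
  ring

lemma enorm_integral_mul_le_peetre {d : ℕ} {σ R A : ℝ} (hR : 0 < R) (hA : 0 ≤ A)
    {K : RD d → ℂ}
    (hK : ∀ y, ‖K y‖ ≤ A * (R ^ d * (1 + R * ‖y‖) ^ (-(σ + (d + 1)))))
    (g : RD d → ℂ) (x : RD d) :
    ‖∫ y, K y * g (x - y)‖ₑ ≤
      ENNReal.ofReal (A * ∫ u : RD d, (1 + ‖u‖) ^ (-((d : ℝ) + 1))) * peetre σ R g x := by
  have hpos (y : RD d) : 0 < 1 + R * ‖y‖ := by positivity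
  have hg (y : RD d) : ‖g (x - y)‖ₑ ≤
      peetre σ R g x * ENNReal.ofReal ((1 + R * ‖y‖) ^ σ) := by
    have h1 : ENNReal.ofReal ((1 + R * ‖y‖) ^ σ) ≠ 0 := by
      simpa using Real.rpow_pos_of_pos (hpos y) σ
    rw [← ENNReal.div_le_iff h1 ENNReal.ofReal_ne_top]
    exact le_iSup (fun y => (‖g (x - y)‖₊ : ℝ≥0∞) / ENNReal.ofReal ((1 + R * ‖y‖) ^ σ)) y
  have hint : Integrable (fun u : RD d => (1 + ‖u‖) ^ (-((d : ℝ) + 1))) :=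
    integrable_one_add_norm (by simp)
  have hintR : Integrable (fun y : RD d => R ^ d • (1 + ‖R • y‖) ^ (-((d : ℝ) + 1))) :=
    (hint.comp_smul hR.ne').const_mul _
  calc ‖∫ y, K y * g (x - y)‖ₑ ≤ ∫⁻ y, ‖K y * g (x - y)‖ₑ := enorm_integral_le_lintegral_enorm _
    _ ≤ ∫⁻ y, ENNReal.ofReal (A * (R ^ d • (1 + ‖R • y‖) ^ (-((d : ℝ) + 1)))) *
          peetre σ R g x := by
        refine lintegral_mono fun y => ?_
        rw [enorm_mul]
        have h2 : ‖K y‖ₑ ≤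
            ENNReal.ofReal (A * (R ^ d * (1 + R * ‖y‖) ^ (-(σ + (d + 1))))) := by
          rw [← ofReal_norm]
          exact ENNReal.ofReal_le_ofReal (hK y)
        calc _ ≤ _ := mul_le_mul' h2 (hg y)
          _ = _ := by
            rw [mul_comm (peetre σ R g x), ← mul_assoc, ← ENNReal.ofReal_mul
              (by have := Real.rpow_nonneg (hpos y).le (-(σ + (d + 1))); positivity),
              norm_smul, Real.norm_of_nonneg hR.le, smul_eq_mul, mul_assoc, mul_assoc,
              ← Real.rpow_add (hpos y)]
            congr 5
            ring
    _ = _ := by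
        rw [lintegral_mul_const _ (by fun_prop), ← ofReal_integral_eq_lintegral_ofReal
          (hintR.const_mul A) (ae_of_all _ fun y => by positivity), integral_const_mul,
          integral_dilate (fun u : RD d => (1 + ‖u‖) ^ (-((d : ℝ) + 1))) hR]

lemma enorm_integral_dilate_mul_le {d : ℕ} (φ : 𝓢(RD d, ℂ)) {R : ℝ} (hR : 0 < R)
    {T : RD d → ℂ} {M : ℝ≥0∞} (hT : ∀ y, ‖T y‖ₑ ≤ M) :
    ‖∫ y, dilateS φ R hR.ne' y * T y‖ₑ ≤ ENNReal.ofReal (∫ y, ‖φ y‖) * M := by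
  calc _ ≤ ∫⁻ y, ‖dilateS φ R hR.ne' y * T y‖ₑ := enorm_integral_le_lintegral_enorm _
    _ ≤ ∫⁻ y, ‖dilateS φ R hR.ne' y‖ₑ * M := by
        refine lintegral_mono fun y => ?_
        rw [enorm_mul]
        gcongr
        exact hT y
    _ = _ := by
        rw [lintegral_mul_const _ (dilateS φ R hR.ne').continuous.measurable.enorm,
          ← ofReal_integral_norm_eq_lintegral_enorm (dilateS φ R hR.ne').integrable,
          ← integral_dilate (fun y => ‖φ y‖) hR]
        simp [dilateS_apply, abs_of_pos hR]

section LittlewoodPaley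

variable {d : ℕ} (D : LPData d)

lemma LPData.norm_mem_of_ne_zero {η : RD d} (h : fourierS D.φ η ≠ 0) :
    1 / 2 < ‖η‖ ∧ ‖η‖ < 2 := by
  constructor
  · by_contra! hη
    have hzero : Set.EqOn (fourierS D.φ) 0 (Metric.ball 0 (1 / 2)) := fun ξ hξ => by
      by_contra hne
      have := (D.supp_φ ξ hne).1
      rw [mem_ball_zero_iff] at hξ
      linarith
    have := hzero.closure (fourierS D.φ).continuous continuous_zero
    rw [closure_ball _ (by norm_num)] at this
    exact h (this (by simpa using hη))
  · have hsub : Function.support (fourierS D.φ) ⊆ interior (Metric.closedBall 0 2) :=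
      interior_maximal (fun ξ hξ => by simpa using (D.supp_φ ξ hξ).2)
        ((fourierS D.φ).continuous.isOpen_support)
    rw [interior_closedBall _ (by norm_num)] at hsub
    simpa using hsub h

lemma LPData.sum_three_eq_one {n : ℕ} {ξ : RD d}
    (h : fourierS D.φ (((2 : ℝ) ^ (n + 2))⁻¹ • ξ) ≠ 0) :
    fourierS D.φ (((2 : ℝ) ^ (n + 1))⁻¹ • ξ) + fourierS D.φ (((2 : ℝ) ^ (n + 2))⁻¹ • ξ) +
      fourierS D.φ (((2 : ℝ) ^ (n + 3))⁻¹ • ξ) = 1 := by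
  have key : ∀ l : ℤ, fourierS D.φ ((2 : ℝ) ^ (-l) • ξ) ≠ 0 →
      (2 : ℝ) ^ (l - 1) < ‖ξ‖ ∧ ‖ξ‖ < (2 : ℝ) ^ (l + 1) := fun l hl => by
    have := D.norm_mem_of_ne_zero hl
    rw [norm_smul, norm_zpow, zpow_neg, Real.norm_ofNat] at this
    have h2 : (0 : ℝ) < 2 ^ l := by positivity
    rw [zpow_sub_one₀ two_ne_zero, zpow_add_one₀ two_ne_zero]
    rw [inv_mul_eq_div, lt_div_iff₀ h2, div_lt_iff₀ h2] at this
    constructor <;> linarith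
  have hpow (j : ℕ) : ((2 : ℝ) ^ j)⁻¹ = 2 ^ (-(j : ℤ)) := by simp
  rw [hpow] at h
  have hξ : ξ ≠ 0 := by
    rintro rfl
    have := (key _ h).1
    rw [norm_zero] at this
    exact absurd this (not_lt.2 (by positivity))
  have hsum := D.sum_φ ξ hξ
  have hfin := hasSum_sum_of_ne_finset_zero (L := SummationFilter.unconditional ℤ)
    (f := fun k : ℤ => fourierS D.φ ((2 : ℝ) ^ (-k) • ξ))
    (s := {((n + 1 : ℕ) : ℤ), ((n + 2 : ℕ) : ℤ), ((n + 3 : ℕ) : ℤ)}) (fun l hl => by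
      by_contra hne
      have h1 := key _ h
      have h2 := key _ hne
      have h3 := (zpow_lt_zpow_iff_right₀ (one_lt_two (α := ℝ))).1 (h1.1.trans h2.2)
      have h4 := (zpow_lt_zpow_iff_right₀ (one_lt_two (α := ℝ))).1 (h2.1.trans h1.2)
      simp only [Finset.mem_insert, Finset.mem_singleton, not_or] at hl
      push_cast at *
      omega)
  have := hfin.unique hsum
  rw [Finset.sum_insert (by simp), Finset.sum_insert (by simp), Finset.sum_singleton] at this
  rw [hpow, hpow, hpow, ← this, add_assoc]

/-- The Littlewood–Paley kernel of positive level as a Schwartz function. -/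
abbrev LPData.kernelS (j : ℕ) : 𝓢(RD d, ℂ) := dilateS D.φ ((2 : ℝ) ^ j) (by positivity)

lemma LPkernel_succ (j : ℕ) : LPkernel D (j + 1) = D.kernelS (j + 1) := by
  ext x
  rw [dilateS_apply, ← pow_mul]
  rfl

lemma LPstar_eq_convS (n : ℕ) (f : 𝓢(RD d, ℂ)) :
    LPstar D (n + 2) f =
      convS (D.kernelS (n + 1) + D.kernelS (n + 2) + D.kernelS (n + 3)) f := by
  have hLP (j : ℕ) (x : RD d) : LP D (j + 1) f x = convS (D.kernelS (j + 1)) f x := by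
    rw [convS_apply, ← LPkernel_succ]
    rfl
  ext x
  simp only [LPstar, convS, map_add, _root_.add_apply]
  simp [hLP, convS]

end LittlewoodPaley

lemma exists_norm_fourierInv_le {d : ℕ} {S : Set 𝓢(RD d, ℂ)}
    (hS : ∀ p q : ℕ, ∃ M : ℝ, ∀ b ∈ S, SchwartzMap.seminorm ℂ p q b ≤ M) (s : ℝ) :
    ∃ C : ℝ, 0 ≤ C ∧ ∀ b ∈ S, ∀ y : RD d, ‖𝓕⁻ b y‖ ≤ C * (1 + ‖y‖) ^ (-s) := by
  have hw := schwartz_withSeminorms ℂ (RD d) ℂ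
  have hbdd : Bornology.IsVonNBounded ℂ S :=
    hw.isVonNBounded_iff_seminorm_bounded.2 fun i => by
      obtain ⟨M, hM⟩ := hS i.1 i.2
      exact ⟨max M 0 + 1, by positivity, fun b hb =>
        lt_of_le_of_lt ((hM b hb).trans (le_max_left M 0)) (lt_add_one _)⟩
  have himage := hbdd.image (FourierTransform.fourierInvCLM ℂ 𝓢(RD d, ℂ))
  rw [hw.image_isVonNBounded_iff_finset_seminorm_bounded] at himage
  obtain ⟨N, hN⟩ := exists_nat_ge s
  obtain ⟨r, hr, hrb⟩ := himage (Finset.Iic (N, 0))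
  refine ⟨2 ^ N * r, by positivity, fun b hb y => ?_⟩
  have h1 := SchwartzMap.one_add_le_sup_seminorm_apply (𝕜 := ℂ) (m := (N, 0)) le_rfl le_rfl
    (𝓕⁻ b) y
  rw [norm_iteratedFDeriv_zero] at h1
  have h2 : (1 + ‖y‖) ^ N * ‖𝓕⁻ b y‖ ≤ 2 ^ N * r :=
    h1.trans (mul_le_mul_of_nonneg_left (hrb b hb).le (by positivity))
  have hy : (0 : ℝ) < 1 + ‖y‖ := by positivity
  rw [Real.rpow_neg hy.le, ← div_eq_mul_inv, le_div_iff₀ (by positivity), mul_comm]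
  refine le_trans ?_ h2
  gcongr
  rw [← Real.rpow_natCast]
  exact Real.rpow_le_rpow_of_exponent_le (by simp) hN

lemma Real.rpow_le_three_rpow_abs {t : ℝ} (ht : 1 / 3 ≤ t) (ht' : t ≤ 3) (s : ℝ) :
    t ^ s ≤ 3 ^ |s| := by
  have h0 : 0 < t := by linarith
  rcases le_total 0 s with hs | hs
  · rw [abs_of_nonneg hs]
    exact Real.rpow_le_rpow h0.le ht' hs
  · rw [abs_of_nonpos hs, ← inv_inv t, Real.inv_rpow (by positivity), ← Real.rpow_neg (by positivity)]
    refine Real.rpow_le_rpow (by positivity) ?_ (by linarith)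
    rw [inv_le_comm₀ h0 (by norm_num)]
    linarith

section LocalizedSymbol

variable {d : ℕ} {m : ℝ} {a : RD d → RD d → ℂ}

lemma IsSymbolS11.contDiff_right (ha : IsSymbolS11 d m a) (z : RD d) : ContDiff ℝ ∞ (a z) :=
  ha.1.comp (contDiff_const.prodMk contDiff_id)

lemma IsSymbolS11.exists_norm_iteratedFDeriv_le (ha : IsSymbolS11 d m a) (n : ℕ) :
    ∃ c : ℝ, 0 ≤ c ∧ ∀ z ξ : RD d,
      ‖iteratedFDeriv ℝ n (a z) ξ‖ ≤ c * (1 + ‖ξ‖) ^ (m - n) := by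
  obtain ⟨c, hc⟩ := ha.2 n 0
  refine ⟨|c|, abs_nonneg c, fun z ξ => ?_⟩
  have h := hc z ξ
  simp only [iteratedFDeriv_zero_eq_comp, Function.comp_def] at h
  have hcomp := LinearIsometryEquiv.norm_iteratedFDeriv_comp_left
    (continuousMultilinearCurryFin0 ℝ (RD d) ℂ).symm (a z) ξ n
  simp only [Function.comp_def] at hcomp
  rw [hcomp] at h
  refine h.trans ?_
  rw [Nat.cast_zero, add_zero]
  gcongr
  exact le_abs_self c

variable (D : LPData d)

/-- The rescaled symbol `η ↦ R^{-m} a(z, R η) φ̂(η)`. -/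
def locFun (m : ℝ) (a : RD d → RD d → ℂ) (z : RD d) (R : ℝ) (η : RD d) : ℂ :=
  (((R ^ (-m) : ℝ) : ℂ) * a z (R • η)) * fourierS D.φ η

lemma hasCompactSupport_locFun (z : RD d) (R : ℝ) : HasCompactSupport (locFun D m a z R) :=
  HasCompactSupport.of_support_subset_isCompact (isCompact_closedBall (0 : RD d) 2) fun η hη => by
    simpa using (D.supp_φ η (right_ne_zero_of_mul hη)).2

lemma tsupport_locFun_subset (z : RD d) (R : ℝ) :
    tsupport (locFun D m a z R) ⊆ {η | 1 / 2 ≤ ‖η‖ ∧ ‖η‖ ≤ 2} :=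
  closure_minimal (fun η hη => D.supp_φ η (right_ne_zero_of_mul hη))
    ((isClosed_le continuous_const continuous_norm).inter
      (isClosed_le continuous_norm continuous_const))

lemma IsSymbolS11.contDiff_dilate (ha : IsSymbolS11 d m a) (z : RD d) (R : ℝ) :
    ContDiff ℝ ∞ fun η => ((R ^ (-m) : ℝ) : ℂ) * a z (R • η) :=
  contDiff_const.mul ((ha.contDiff_right z).comp (contDiff_const_smul R))

lemma contDiff_locFun (ha : IsSymbolS11 d m a) (z : RD d) (R : ℝ) :
    ContDiff ℝ ∞ (locFun D m a z R) :=
  (ha.contDiff_dilate z R).mul ((fourierS D.φ).smooth ⊤)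

/-- The rescaled symbol as a Schwartz function. -/
def locS (ha : IsSymbolS11 d m a) (z : RD d) (R : ℝ) : 𝓢(RD d, ℂ) :=
  (hasCompactSupport_locFun D z R).toSchwartzMap (contDiff_locFun D ha z R)

lemma locS_apply (ha : IsSymbolS11 d m a) (z : RD d) (R : ℝ) (η : RD d) :
    locS D ha z R η = (((R ^ (-m) : ℝ) : ℂ) * a z (R • η)) * fourierS D.φ η := rfl

lemma IsSymbolS11.exists_norm_iteratedFDeriv_dilate_le (ha : IsSymbolS11 d m a) (n : ℕ) :
    ∃ c : ℝ, 0 ≤ c ∧ ∀ (z η : RD d) (R : ℝ), 1 ≤ R → 1 / 2 ≤ ‖η‖ → ‖η‖ ≤ 2 →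
      ‖iteratedFDeriv ℝ n (fun η => ((R ^ (-m) : ℝ) : ℂ) * a z (R • η)) η‖ ≤ c := by
  obtain ⟨c, hc0, hc⟩ := ha.exists_norm_iteratedFDeriv_le n
  refine ⟨c * 3 ^ |m - n|, by positivity, fun z η R hR h1 h2 => ?_⟩
  have hR0 : 0 < R := by linarith
  have hsmul : ContDiffAt ℝ n (fun η => a z (R • η)) η :=
    (((ha.contDiff_right z).comp (contDiff_const_smul R)).of_le (mod_cast le_top)).contDiffAt
  have hcomp := (R • ContinuousLinearMap.id ℝ (RD d)).iteratedFDeriv_comp_right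
    (ha.contDiff_right z) η (i := n) (mod_cast le_top)
  have hnorm : ‖iteratedFDeriv ℝ n (fun η => a z (R • η)) η‖ ≤
      c * (1 + ‖R • η‖) ^ (m - n) * R ^ n := by
    change ‖iteratedFDeriv ℝ n (a z ∘ (R • ContinuousLinearMap.id ℝ (RD d))) η‖ ≤ _
    rw [hcomp]
    refine (ContinuousMultilinearMap.norm_compContinuousLinearMap_le _ _).trans ?_
    rw [Finset.prod_const, Finset.card_univ, Fintype.card_fin]
    have hid : ‖R • ContinuousLinearMap.id ℝ (RD d)‖ ≤ R := by
      rw [norm_smul, Real.norm_of_nonneg hR0.le]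
      exact mul_le_of_le_one_right hR0.le ContinuousLinearMap.norm_id_le
    gcongr
    exact hc z (R • η)
  have hconst : iteratedFDeriv ℝ n (fun η => ((R ^ (-m) : ℝ) : ℂ) * a z (R • η)) η =
      ((R ^ (-m) : ℝ) : ℂ) • iteratedFDeriv ℝ n (fun η => a z (R • η)) η :=
    iteratedFDeriv_const_smul_apply (a := ((R ^ (-m) : ℝ) : ℂ)) hsmul
  rw [hconst, norm_smul, Complex.norm_real, Real.norm_of_nonneg (by positivity)]
  have hfac : 1 + ‖R • η‖ = R * (R⁻¹ + ‖η‖) := by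
    rw [norm_smul, Real.norm_of_nonneg hR0.le]
    field_simp
  have hRinv : R⁻¹ ≤ 1 := inv_le_one_of_one_le₀ hR
  have hRinv' : 0 < R⁻¹ := by positivity
  calc _ ≤ R ^ (-m) * (c * (1 + ‖R • η‖) ^ (m - n) * R ^ n) := by gcongr
    _ = c * (R⁻¹ + ‖η‖) ^ (m - n) * (R ^ (-m) * R ^ (m - n) * R ^ (n : ℝ)) := by
        rw [hfac, Real.mul_rpow hR0.le (by positivity), Real.rpow_natCast]
        ring
    _ = c * (R⁻¹ + ‖η‖) ^ (m - n) := by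
        rw [← Real.rpow_add hR0, ← Real.rpow_add hR0]
        ring_nf
        simp
    _ ≤ _ := by
        gcongr
        exact Real.rpow_le_three_rpow_abs (by linarith) (by linarith) _

lemma exists_seminorm_locS_le (ha : IsSymbolS11 d m a) (p q : ℕ) :
    ∃ M : ℝ, ∀ b ∈ {b | ∃ z R, 1 ≤ R ∧ b = locS D ha z R}, SchwartzMap.seminorm ℂ p q b ≤ M := by
  choose c hc0 hc using ha.exists_norm_iteratedFDeriv_dilate_le
  refine ⟨2 ^ p * ∑ i ∈ Finset.range (q + 1),
    (q.choose i : ℝ) * c i * SchwartzMap.seminorm ℂ 0 (q - i) (fourierS D.φ), ?_⟩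
  rintro b ⟨z, R, hR, rfl⟩
  have hsum : 0 ≤ ∑ i ∈ Finset.range (q + 1),
      (q.choose i : ℝ) * c i * SchwartzMap.seminorm ℂ 0 (q - i) (fourierS D.φ) :=
    Finset.sum_nonneg fun i _ => mul_nonneg (mul_nonneg (by positivity) (hc0 i)) (apply_nonneg _ _)
  refine SchwartzMap.seminorm_le_bound ℂ p q _ (by positivity) fun η => ?_
  change ‖η‖ ^ p * ‖iteratedFDeriv ℝ q (locFun D m a z R) η‖ ≤ _
  by_cases hη : η ∈ tsupport (locFun D m a z R)
  · obtain ⟨h1, h2⟩ := tsupport_locFun_subset D z R hη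
    gcongr
    refine (norm_iteratedFDeriv_mul_le (ha.contDiff_dilate z R) ((fourierS D.φ).smooth ⊤) η
      (n := q) (mod_cast le_top)).trans ?_
    gcongr with i _
    · exact mul_nonneg (by positivity) (hc0 i)
    · exact hc i z η R hR h1 h2
    · exact SchwartzMap.norm_iteratedFDeriv_le_seminorm ℂ _ _ _
  · have hzero : iteratedFDeriv ℝ q (locFun D m a z R) η = 0 := by
      by_contra hne
      exact hη (support_iteratedFDeriv_subset q hne)
    rw [hzero, norm_zero, mul_zero]
    positivity

end LocalizedSymbol

section PiecewiseBounds

variable {d : ℕ} {m : ℝ} {a : RD d → RD d → ℂ} (D : LPData d)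

lemma symbol_mul_LPhat_eq (ha : IsSymbolS11 d m a) (n : ℕ) (z ξ : RD d) :
    a z ξ * LPhat D (n + 1) ξ =
      ((((2 : ℝ) ^ (n + 1)) ^ m : ℝ) : ℂ) *
        locS D ha z ((2 : ℝ) ^ (n + 1)) (((2 : ℝ) ^ (n + 1))⁻¹ • ξ) := by
  have hR : (0 : ℝ) < 2 ^ (n + 1) := by positivity
  have hcancel : ((((2 : ℝ) ^ (n + 1)) ^ m : ℝ) : ℂ) *
      ((((2 : ℝ) ^ (n + 1)) ^ (-m) : ℝ) : ℂ) = 1 := by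
    rw [← Complex.ofReal_mul, ← Real.rpow_add hR]
    simp
  rw [locS_apply, smul_inv_smul₀ hR.ne', ← mul_assoc, ← mul_assoc, hcancel, one_mul]
  rfl

lemma exists_norm_symbol_mul_LPhat_le (ha : IsSymbolS11 d m a) (n : ℕ) :
    ∃ M : ℝ, ∀ z ξ : RD d, ‖a z ξ * LPhat D (n + 1) ξ‖ ≤ M := by
  obtain ⟨M, hM⟩ := exists_seminorm_locS_le D ha 0 0
  refine ⟨((2 : ℝ) ^ (n + 1)) ^ m * M, fun z ξ => ?_⟩
  rw [symbol_mul_LPhat_eq D ha, norm_mul, Complex.norm_real, Real.norm_of_nonneg (by positivity)]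
  gcongr
  exact (SchwartzMap.norm_le_seminorm ℂ _ _).trans
    (hM _ ⟨z, _, one_le_pow₀ one_le_two, rfl⟩)

lemma exists_frozen_symbol_bound (ha : IsSymbolS11 d m a) (σ : ℝ) :
    ∃ C : ℝ, ∀ (n : ℕ) (z x : RD d) (f : 𝓢(RD d, ℂ)),
      ‖∫ ξ, a z ξ * LPhat D (n + 2) ξ * fourierS f ξ *
          cexp (2 * Real.pi * I * ((⟪x, ξ⟫ : ℝ) : ℂ))‖ₑ ≤
        ENNReal.ofReal C * (2 : ℝ≥0∞) ^ (((n + 2 : ℕ) : ℝ) * m) *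
          peetre σ ((2 : ℝ) ^ (n + 2)) (LPstar D (n + 2) f) x := by
  obtain ⟨A, hA0, hA⟩ := exists_norm_fourierInv_le (exists_seminorm_locS_le D ha) (σ + (d + 1))
  refine ⟨A * ∫ u : RD d, (1 + ‖u‖) ^ (-((d : ℝ) + 1)), fun n z x f => ?_⟩
  set R : ℝ := 2 ^ (n + 2) with hRdef
  have hR : 0 < R := by positivity
  have hR1 : 1 ≤ R := one_le_pow₀ one_le_two
  set b := locS D ha z R with hb
  set B := dilateS b R⁻¹ (inv_pos.2 hR).ne' with hB
  set W := D.kernelS (n + 1) + D.kernelS (n + 2) + D.kernelS (n + 3) with hW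
  have hFW (ξ : RD d) : 𝓕 W ξ = fourierS D.φ (((2 : ℝ) ^ (n + 1))⁻¹ • ξ) +
      fourierS D.φ (((2 : ℝ) ^ (n + 2))⁻¹ • ξ) + fourierS D.φ (((2 : ℝ) ^ (n + 3))⁻¹ • ξ) := by
    rw [hW, FourierTransform.fourier_add, FourierTransform.fourier_add]
    change 𝓕 (D.kernelS (n + 1)) ξ + 𝓕 (D.kernelS (n + 2)) ξ + 𝓕 (D.kernelS (n + 3)) ξ = _
    rw [fourier_dilateS _ (by positivity), fourier_dilateS _ (by positivity),
      fourier_dilateS _ (by positivity)]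
    rfl
  have hBW (ξ : RD d) : B ξ * 𝓕 W ξ = B ξ := by
    by_cases hφ : fourierS D.φ (R⁻¹ • ξ) = 0
    · rw [hB, dilateS_apply, hb, locS_apply, hφ]
      simp
    · rw [hFW, D.sum_three_eq_one hφ, mul_one]
  have hsymbol (ξ : RD d) :
      a z ξ * LPhat D (n + 2) ξ = ((R ^ m * R ^ d : ℝ) : ℂ) * B ξ := by
    rw [symbol_mul_LPhat_eq D ha, hB, dilateS_apply, ← mul_assoc, ← Complex.ofReal_mul, mul_assoc,
      ← mul_pow, mul_inv_cancel₀ hR.ne', one_pow, mul_one]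
  have hint : ∫ ξ, a z ξ * LPhat D (n + 2) ξ * fourierS f ξ *
      cexp (2 * Real.pi * I * ((⟪x, ξ⟫ : ℝ) : ℂ)) =
      ∫ y, (((R ^ m * R ^ d : ℝ) : ℂ) * 𝓕⁻ B y) * LPstar D (n + 2) f (x - y) := by
    simp only [hsymbol, mul_assoc ((R ^ m * R ^ d : ℝ) : ℂ), integral_const_mul, LPstar_eq_convS]
    congr 1
    exact integral_mul_fourier_mul_exp B W f hBW x
  rw [hint]
  refine (enorm_integral_mul_le_peetre (σ := σ) (A := A * R ^ m) hR (by positivity) (fun y => ?_)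
    _ x).trans_eq ?_
  · have h := hA b ⟨z, R, hR1, rfl⟩ (R • y)
    rw [norm_smul, Real.norm_of_nonneg hR.le] at h
    rw [hB, fourierInv_dilateS b (inv_pos.2 hR), inv_inv, norm_mul, Complex.norm_real,
      Real.norm_of_nonneg (by positivity)]
    calc _ ≤ R ^ m * R ^ d * (A * (1 + R * ‖y‖) ^ (-(σ + (d + 1)))) := by gcongr
      _ = _ := by ring
  · congr 1
    rw [mul_right_comm, ENNReal.ofReal_mul
      (mul_nonneg hA0 (integral_nonneg fun u => by positivity)), hRdef, ← Real.rpow_natCast,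
      ← Real.rpow_mul zero_le_two, ← ENNReal.ofReal_rpow_of_pos two_pos, ENNReal.ofReal_ofNat]

lemma integrable_symbolPiece_kernel (ha : IsSymbolS11 d m a) (j n : ℕ) (x : RD d)
    (f : 𝓢(RD d, ℂ)) :
    Integrable (fun p : RD d × RD d => D.kernelS j p.2 *
      (a (x - p.2) p.1 * LPhat D (n + 1) p.1 * fourierS f p.1 *
        cexp (2 * Real.pi * I * ((⟪x, p.1⟫ : ℝ) : ℂ)))) (volume.prod volume) := by
  obtain ⟨M, hM⟩ := exists_norm_symbol_mul_LPhat_le D ha n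
  have hcont : Continuous fun p : RD d × RD d => D.kernelS j p.2 *
      (a (x - p.2) p.1 * LPhat D (n + 1) p.1 * fourierS f p.1 *
        cexp (2 * Real.pi * I * ((⟪x, p.1⟫ : ℝ) : ℂ))) := by
    have h1 : Continuous fun p : RD d × RD d => a (x - p.2) p.1 :=
      ha.1.continuous.comp (by fun_prop : Continuous fun p : RD d × RD d => (x - p.2, p.1))
    have h2 : Continuous (LPhat D (n + 1)) :=
      (fourierS D.φ).continuous.comp (continuous_const_smul _)
    have h3 : Continuous (D.kernelS j) := (D.kernelS j).continuous
    exact (h3.comp continuous_snd).mul (((h1.mul (h2.comp continuous_fst)).mul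
      ((fourierS f).continuous.comp continuous_fst)).mul (by fun_prop))
  refine (((fourierS f).integrable.norm.mul_prod (D.kernelS j).integrable.norm).const_mul M).mono'
    hcont.aestronglyMeasurable (ae_of_all _ fun p => ?_)
  have hexp : ‖cexp (2 * Real.pi * I * ((⟪x, p.1⟫ : ℝ) : ℂ))‖ = 1 := by
    rw [show (2 * Real.pi * I * ((⟪x, p.1⟫ : ℝ) : ℂ)) =
      ((2 * Real.pi * ⟪x, p.1⟫ : ℝ) : ℂ) * I by push_cast; ring]
    exact Complex.norm_exp_ofReal_mul_I _
  rw [norm_mul, norm_mul, norm_mul _ (fourierS f p.1), hexp]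
  calc _ ≤ ‖D.kernelS j p.2‖ * (M * ‖fourierS f p.1‖ * 1) := by
        gcongr
        exact hM _ _
    _ = _ := by ring

lemma symbolPiece_mul_eq (j k : ℕ) (x ξ : RD d) (f : 𝓢(RD d, ℂ)) :
    symbolPiece D a (j + 1) k x ξ * fourierS f ξ * cexp (2 * Real.pi * I * ((⟪x, ξ⟫ : ℝ) : ℂ)) =
      ∫ y, D.kernelS (j + 1) y * (a (x - y) ξ * LPhat D k ξ * fourierS f ξ *
        cexp (2 * Real.pi * I * ((⟪x, ξ⟫ : ℝ) : ℂ))) := by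
  simp only [symbolPiece, LPkernel_succ, ← mul_assoc, integral_mul_const]

lemma integrable_symbolPiece (ha : IsSymbolS11 d m a) (j n : ℕ) (x : RD d) (f : 𝓢(RD d, ℂ)) :
    Integrable fun ξ => symbolPiece D a (j + 1) (n + 1) x ξ * fourierS f ξ *
      cexp (2 * Real.pi * I * ((⟪x, ξ⟫ : ℝ) : ℂ)) := by
  simp only [symbolPiece_mul_eq]
  exact (integrable_symbolPiece_kernel D ha (j + 1) n x f).integral_prod_left

lemma pdo_symbolPiece_eq (ha : IsSymbolS11 d m a) (j n : ℕ) (x : RD d) (f : 𝓢(RD d, ℂ)) :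
    pdo (symbolPiece D a (j + 1) (n + 1)) f x =
      ∫ y, D.kernelS (j + 1) y * ∫ ξ, a (x - y) ξ * LPhat D (n + 1) ξ * fourierS f ξ *
        cexp (2 * Real.pi * I * ((⟪x, ξ⟫ : ℝ) : ℂ)) := by
  simp only [pdo, symbolPiece_mul_eq]
  rw [integral_integral_swap (integrable_symbolPiece_kernel D ha (j + 1) n x f)]
  simp only [integral_const_mul]

lemma exists_pdo_symbolPiece_bound (ha : IsSymbolS11 d m a) (σ : ℝ) :
    ∃ C : ℝ≥0, ∀ (j n : ℕ) (x : RD d) (f : 𝓢(RD d, ℂ)),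
      ‖pdo (symbolPiece D a (j + 1) (n + 2)) f x‖ₑ ≤
        C * (2 : ℝ≥0∞) ^ (((n + 2 : ℕ) : ℝ) * m) *
          peetre σ ((2 : ℝ) ^ (n + 2)) (LPstar D (n + 2) f) x := by
  obtain ⟨C, hC⟩ := exists_frozen_symbol_bound D ha σ
  refine ⟨(∫ y, ‖D.φ y‖).toNNReal * C.toNNReal, fun j n x f => ?_⟩
  rw [pdo_symbolPiece_eq D ha]
  refine (enorm_integral_dilate_mul_le D.φ (by positivity) fun y =>
    hC n (x - y) x f).trans_eq ?_
  rw [ENNReal.coe_mul, mul_assoc, mul_assoc, mul_assoc]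
  rfl

end PiecewiseBounds


/-- the pointwise bound `|T_{d_k} f(x)| ≲ 2^{km} 𝔐_{σ,2^k}(Π*_k f)(x)`
for the near-diagonal symbols `d_k`, uniformly in `k ≥ 3`, `x`, `f`. -/
theorem statement16 (d : ℕ) (hd : 1 ≤ d) (m : ℝ)
    (D : LPData d) (a : RD d → RD d → ℂ) (ha : IsSymbolS11 d m a)
    (σ : ℝ) (hσ : 0 < σ) :
    ∃ C : ℝ≥0, ∀ k : ℕ, 3 ≤ k → ∀ (x : RD d) (f : 𝓢(RD d, ℂ)),
      (‖pdo (dsym D a k) f x‖₊ : ℝ≥0∞) ≤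
        (C : ℝ≥0∞) * (2:ℝ≥0∞)^((k:ℝ)*m) * peetre σ ((2:ℝ)^k) (LPstar D k (⇑f)) x := by
  obtain ⟨C, hC⟩ := exists_pdo_symbolPiece_bound D ha σ
  refine ⟨5 * C, fun k hk x f => ?_⟩
  obtain ⟨n, rfl⟩ : ∃ n, k = n + 3 := ⟨k - 3, by omega⟩
  have hsum : pdo (dsym D a (n + 3)) f x =
      ∑ i ∈ Finset.Icc n (n + 4), pdo (symbolPiece D a (i + 1) (n + 3)) f x := by
    have hIcc : Finset.Icc (n + 3 - 2) (n + 3 + 2) =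
        (Finset.Icc n (n + 4)).map (addRightEmbedding 1) := by
      rw [Finset.map_add_right_Icc]
      rfl
    simp only [pdo, dsym, hIcc, Finset.sum_map, addRightEmbedding_apply, Finset.sum_mul]
    exact integral_finsetSum _ fun i _ => integrable_symbolPiece D ha i (n + 2) x f
  rw [hsum]
  refine (enorm_sum_le _ _).trans ((Finset.sum_le_card_nsmul _ _ _ fun i _ =>
    hC i (n + 1) x f).trans_eq ?_)
  rw [Nat.card_Icc, show n + 4 + 1 - n = 5 by omega, nsmul_eq_mul, ENNReal.coe_mul,
    mul_assoc, mul_assoc, mul_assoc]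
  rfl

end
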